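/- (Tempering-Kernel Lemma) Let X be a measurable space and let f : X → X be a measurable bijection whose inverse is measurable. Let K : X → ℝ be a measurable function with K(x) > 0 for all x, which is tempered in the sense that for every x ∈ X, (1/n)·log K(fⁿ(x)) → 0 as n → +∞ and as n → −∞. Then for every ε > 0 there exists a measurable function K_ε : X → ℝ such that K(x) ≤ K_ε(x) for all x and e^{−ε} ≤ K_ε(f(x))/K_ε(x) ≤ e^{ε} for all x ∈ X. -/

import Mathlib

open Filter Topology

lemma tk_bdd {X : Type*} (f : X → X) (K : X → ℝ) (hKpos : ∀ x, 0 < K x) (x : X)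
    (h : Tendsto (fun n : ℕ => Real.log (K (f^[n] x)) / n) atTop (𝓝 0)) (ε : ℝ) (hε : 0 < ε) :
    BddAbove (Set.range fun n : ℕ => K (f^[n] x) * Real.exp (-ε * n)) := by
  apply Filter.IsBoundedUnder.bddAbove_range
  refine ⟨1, ?_⟩
  rw [Filter.eventually_map]
  filter_upwards [h.eventually (gt_mem_nhds hε), eventually_gt_atTop 0] with n hn hn0
  have hn' : (0 : ℝ) < n := by exact_mod_cast hn0
  rw [div_lt_iff₀ hn'] at hn
  calc K (f^[n] x) * Real.exp (-ε * n)
      = Real.exp (Real.log (K (f^[n] x))) * Real.exp (-ε * n) := by rw [Real.exp_log (hKpos _)]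
    _ = Real.exp (Real.log (K (f^[n] x)) + -ε * n) := (Real.exp_add _ _).symm
    _ ≤ 1 := by rw [Real.exp_le_one_iff]; linarith

noncomputable def tkA {X : Type*} (f : X → X) (K : X → ℝ) (ε : ℝ) (x : X) : ℝ :=
  ⨆ n : ℕ, K (f^[n] x) * Real.exp (-ε * n)

lemma tk_half {X : Type*} (f g : X → X) (hgf : Function.LeftInverse g f)
    (K : X → ℝ) (hKpos : ∀ x, 0 < K x) (ε : ℝ) (hε : 0 < ε)
    (hF : ∀ x, BddAbove (Set.range fun n : ℕ => K (f^[n] x) * Real.exp (-ε * n)))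
    (hG : ∀ x, BddAbove (Set.range fun n : ℕ => K (g^[n] x) * Real.exp (-ε * n))) (x : X) :
    max (tkA f K ε (f x)) (tkA g K ε (f x)) ≤
      Real.exp ε * max (tkA f K ε x) (tkA g K ε x) := by
  have key : ∀ n : ℕ, K (f^[n] (f x)) * Real.exp (-ε * n) ≤
      Real.exp ε * max (tkA f K ε x) (tkA g K ε x) := by
    intro n
    have h1 : K (f^[n+1] x) * Real.exp (-ε * (n+1 : ℕ)) ≤ tkA f K ε x := le_ciSup (hF x) (n+1)
    have h2 : K (f^[n] (f x)) * Real.exp (-ε * n) =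
        Real.exp ε * (K (f^[n+1] x) * Real.exp (-ε * (n+1 : ℕ))) := by
      rw [Function.iterate_succ_apply, mul_left_comm, ← Real.exp_add]
      congr 2
      push_cast
      ring
    rw [h2]
    exact mul_le_mul_of_nonneg_left (h1.trans (le_max_left _ _)) (Real.exp_pos _).le
  refine max_le (ciSup_le key) (ciSup_le ?_)
  rintro (_ | n)
  · simpa using key 0
  · have h1 : K (g^[n] x) * Real.exp (-ε * n) ≤ tkA g K ε x := le_ciSup (hG x) n
    rw [Function.iterate_succ_apply, hgf x]
    refine le_trans ?_ (mul_le_mul_of_nonneg_left (h1.trans (le_max_right _ _))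
      (Real.exp_pos ε).le)
    rw [mul_left_comm, ← Real.exp_add]
    apply mul_le_mul_of_nonneg_left _ (hKpos _).le
    rw [Real.exp_le_exp]
    push_cast
    linarith

lemma tk_meas {X : Type*} [MeasurableSpace X] (f : X → X) (hf : Measurable f)
    (K : X → ℝ) (hK : Measurable K) (ε : ℝ) : Measurable (tkA f K ε) :=
  Measurable.iSup fun n => (hK.comp (hf.iterate n)).mul_const _

/-- Tempering-Kernel Lemma: if `K` is a positive measurable tempered function over an
invertible measurable dynamical system `(X, f)` (with measurable inverse `g`), then for
every `ε > 0` there is a measurable function `Kε ≥ K` whose ratio along the dynamics is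
pinched between `e^{-ε}` and `e^{ε}`. -/
theorem tempering_kernel_lemma {X : Type*} [MeasurableSpace X]
    (f g : X → X) (hf : Measurable f) (hg : Measurable g)
    (hgf : Function.LeftInverse g f) (hfg : Function.RightInverse g f)
    (K : X → ℝ) (hK : Measurable K) (hKpos : ∀ x, 0 < K x)
    (htemp_fwd : ∀ x, Tendsto (fun n : ℕ => Real.log (K (f^[n] x)) / n) atTop (𝓝 0))
    (htemp_bwd : ∀ x, Tendsto (fun n : ℕ => Real.log (K (g^[n] x)) / n) atTop (𝓝 0)) :
    ∀ ε : ℝ, 0 < ε →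
      ∃ Kε : X → ℝ, Measurable Kε ∧ (∀ x, K x ≤ Kε x) ∧
        ∀ x, Real.exp (-ε) ≤ Kε (f x) / Kε x ∧ Kε (f x) / Kε x ≤ Real.exp ε := by
  intro ε hε
  have hF := fun x => tk_bdd f K hKpos x (htemp_fwd x) ε hε
  have hG := fun x => tk_bdd g K hKpos x (htemp_bwd x) ε hε
  have hle : ∀ x, K x ≤ max (tkA f K ε x) (tkA g K ε x) := by
    intro x
    refine le_trans ?_ (le_max_left _ _)
    have h := le_ciSup (hF x) 0
    simpa [tkA] using h
  refine ⟨fun x => max (tkA f K ε x) (tkA g K ε x),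
    (tk_meas f hf K hK ε).max (tk_meas g hg K hK ε), hle, fun x => ?_⟩
  have hpos := (hKpos x).trans_le (hle x)
  constructor
  · have h := tk_half g f hfg K hKpos ε hε hG hF (f x)
    rw [hgf x, max_comm, max_comm (tkA g K ε (f x))] at h
    rw [le_div_iff₀ hpos, Real.exp_neg, inv_mul_le_iff₀ (Real.exp_pos _)]
    exact h
  · rw [div_le_iff₀ hpos]
    exact tk_half f g hgf K hKpos ε hε hF hG x
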